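/- arXiv:1906.05065 — 2 statements merged into one kernel-verified Lean document; each statement's English description precedes it below -/
import Mathlib

section
/- For all S, K, τ > 0 and r, δ ∈ ℝ, the Black–Scholes call price is differentiable in the volatility parameter with derivative (the Vega) ∂C/∂σ (S, σ, r, δ, K, τ) = S e^{-δτ} φ(d₊) √τ > 0; consequently σ ↦ C(S, σ, r, δ, K, τ) is strictly increasing on (0, ∞). -/
open Real Filter Set

/-- Standard normal CDF. -/
noncomputable def stdNormalCDF (x : ℝ) : ℝ :=
  (Real.sqrt (2 * Real.pi))⁻¹ * ∫ t in Set.Iic x, Real.exp (-t ^ 2 / 2)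

/-- Standard normal density. -/
noncomputable def stdNormalPDF (x : ℝ) : ℝ :=
  (Real.sqrt (2 * Real.pi))⁻¹ * Real.exp (-x ^ 2 / 2)

/-- d₊ in the Black–Scholes formula. -/
noncomputable def dPlus (S σ r δ K τ : ℝ) : ℝ :=
  (Real.log (S / K) + (r - δ) * τ) / (σ * Real.sqrt τ) + σ * Real.sqrt τ / 2

/-- d₋ in the Black–Scholes formula. -/
noncomputable def dMinus (S σ r δ K τ : ℝ) : ℝ :=
  (Real.log (S / K) + (r - δ) * τ) / (σ * Real.sqrt τ) - σ * Real.sqrt τ / 2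

/-- Black–Scholes call price. -/
noncomputable def bsCall (S σ r δ K τ : ℝ) : ℝ :=
  S * Real.exp (-δ * τ) * stdNormalCDF (dPlus S σ r δ K τ)
    - K * Real.exp (-r * τ) * stdNormalCDF (dMinus S σ r δ K τ)

lemma aux_integrable : MeasureTheory.Integrable (fun t : ℝ => Real.exp (-t ^ 2 / 2)) := by
  have h := integrable_exp_neg_mul_sq (b := 1 / 2) (by norm_num)
  refine h.congr (Filter.Eventually.of_forall fun t => ?_)
  simp only
  congr 1
  ring

lemma aux_cdf (x : ℝ) : HasDerivAt stdNormalCDF (stdNormalPDF x) x := by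
  unfold stdNormalCDF stdNormalPDF
  refine HasDerivAt.const_mul _ ?_
  have hc : Continuous (fun t : ℝ => Real.exp (-t ^ 2 / 2)) := by fun_prop
  have h1 : HasDerivAt (fun y => (∫ t in Set.Iic 0, Real.exp (-t ^ 2 / 2))
      + ∫ t in (0:ℝ)..y, Real.exp (-t ^ 2 / 2)) (Real.exp (-x ^ 2 / 2)) x :=
    (intervalIntegral.integral_hasDerivAt_right (hc.intervalIntegrable _ _)
      hc.stronglyMeasurable.stronglyMeasurableAtFilter hc.continuousAt).const_add _
  refine h1.congr_of_eventuallyEq (Filter.Eventually.of_forall fun y => ?_)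
  have := intervalIntegral.integral_Iic_sub_Iic (a := 0) (b := y)
    aux_integrable.integrableOn aux_integrable.integrableOn
  simp only
  linarith

lemma aux_key (S K τ r δ σ : ℝ) (hS : 0 < S) (hK : 0 < K) (hτ : 0 < τ) (hσ : 0 < σ) :
    K * Real.exp (-r * τ) * stdNormalPDF (dMinus S σ r δ K τ)
      = S * Real.exp (-δ * τ) * stdNormalPDF (dPlus S σ r δ K τ) := by
  have hq : 0 < Real.sqrt τ := Real.sqrt_pos.2 hτ
  unfold stdNormalPDF
  have h : K * Real.exp (-r * τ) * Real.exp (-(dMinus S σ r δ K τ) ^ 2 / 2)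
      = S * Real.exp (-δ * τ) * Real.exp (-(dPlus S σ r δ K τ) ^ 2 / 2) := by
    rw [← Real.exp_log hS, ← Real.exp_log hK]
    simp only [← Real.exp_add]
    rw [Real.exp_log hS, Real.exp_log hK]
    congr 1
    unfold dPlus dMinus
    rw [Real.log_div hS.ne' hK.ne']
    field_simp
    ring
  linear_combination (Real.sqrt (2 * Real.pi))⁻¹ * h

/-- The Black–Scholes call price is differentiable in volatility with positive derivative
(the Vega), hence strictly increasing in `σ` on `(0, ∞)`. -/
theorem stmt_3 (S K τ r δ : ℝ) (hS : 0 < S) (hK : 0 < K) (hτ : 0 < τ) :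
    (∀ σ : ℝ, 0 < σ →
      HasDerivAt (fun σ' => bsCall S σ' r δ K τ)
        (S * Real.exp (-δ * τ) * stdNormalPDF (dPlus S σ r δ K τ) * Real.sqrt τ) σ ∧
      0 < S * Real.exp (-δ * τ) * stdNormalPDF (dPlus S σ r δ K τ) * Real.sqrt τ) ∧
    StrictMonoOn (fun σ => bsCall S σ r δ K τ) (Set.Ioi 0) := by
  have hq : 0 < Real.sqrt τ := Real.sqrt_pos.2 hτ
  have main : ∀ σ : ℝ, 0 < σ →
      HasDerivAt (fun σ' => bsCall S σ' r δ K τ)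
        (S * Real.exp (-δ * τ) * stdNormalPDF (dPlus S σ r δ K τ) * Real.sqrt τ) σ ∧
      0 < S * Real.exp (-δ * τ) * stdNormalPDF (dPlus S σ r δ K τ) * Real.sqrt τ := by
    intro σ hσ
    constructor
    · have hl : HasDerivAt (fun s : ℝ => s * Real.sqrt τ) (Real.sqrt τ) σ := by
        simpa using (hasDerivAt_id σ).mul_const (Real.sqrt τ)
      obtain ⟨a, ha⟩ : ∃ a, HasDerivAt (fun s : ℝ =>
          (Real.log (S / K) + (r - δ) * τ) / (s * Real.sqrt τ)) a σ :=
        ⟨_, (hasDerivAt_const σ _).div hl (by positivity)⟩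
      have hp : HasDerivAt (fun s => dPlus S s r δ K τ) (a + Real.sqrt τ / 2) σ :=
        ha.add (hl.div_const 2)
      have hm : HasDerivAt (fun s => dMinus S s r δ K τ) (a - Real.sqrt τ / 2) σ :=
        ha.sub (hl.div_const 2)
      have h := (((aux_cdf _).comp σ hp).const_mul (S * Real.exp (-δ * τ))).sub
        (((aux_cdf _).comp σ hm).const_mul (K * Real.exp (-r * τ)))
      refine h.congr_deriv ?_
      linear_combination (-(a - Real.sqrt τ / 2)) * aux_key S K τ r δ σ hS hK hτ hσ
    · unfold stdNormalPDF
      positivity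
  refine ⟨main, ?_⟩
  refine strictMonoOn_of_deriv_pos (convex_Ioi 0)
    (fun σ hσ => (main σ hσ).1.continuousAt.continuousWithinAt) fun σ hσ => ?_
  rw [interior_Ioi] at hσ
  rw [(main σ hσ).1.deriv]
  exact (main σ hσ).2
end

section
/- For all S, K, σ, τ > 0 and r, δ ∈ ℝ, the Black–Scholes call price satisfies the strict no-arbitrage bounds max(S e^{-δτ} − K e^{-rτ}, 0) < C(S, σ, r, δ, K, τ) < S e^{-δτ}. -/
open Real Filter Set

open MeasureTheory in
lemma bs_int : Integrable (fun t : ℝ => Real.exp (-t ^ 2 / 2)) := by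
  have := integrable_exp_neg_mul_sq (b := 1/2) (by norm_num)
  convert this using 3
  ring

open MeasureTheory in
lemma bs_total : ∫ t : ℝ, Real.exp (-t ^ 2 / 2) = Real.sqrt (2 * Real.pi) := by
  have := integral_gaussian (1/2)
  convert this using 2
  · ext t; congr 1; ring
  · ring

open MeasureTheory in
lemma bs_pos (g : ℝ → ℝ) (s : Set ℝ) (hs : IsOpen s) (hne : s.Nonempty) (hg : Integrable g)
    (h : ∀ t ∈ s, 0 < g t) : 0 < ∫ t in s, g t := by
  rw [setIntegral_pos_iff_support_of_nonneg_ae]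
  · have : Function.support g ∩ s = s := by
      apply Set.inter_eq_right.2
      intro t ht
      exact (h t ht).ne'
    rw [this]
    exact hs.measure_pos volume hne
  · exact (ae_restrict_iff' hs.measurableSet).2 (ae_of_all _ fun t ht => (h t ht).le)
  · exact hg.integrableOn

open MeasureTheory in
lemma bs_compl (x : ℝ) : 1 - stdNormalCDF x =
    (Real.sqrt (2 * Real.pi))⁻¹ * ∫ t in Set.Ioi x, Real.exp (-t ^ 2 / 2) := by
  have h := intervalIntegral.integral_Iic_add_Ioi (b := x) bs_int.integrableOn bs_int.integrableOn
  rw [bs_total] at h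
  have hp : 0 < Real.sqrt (2 * Real.pi) := by positivity
  unfold stdNormalCDF
  rw [← eq_sub_iff_add_eq'] at h
  rw [h]
  field_simp

lemma bs_inv_pos : 0 < (Real.sqrt (2 * Real.pi))⁻¹ := by positivity

open MeasureTheory in
lemma bs_cdf_pos (x : ℝ) : 0 < stdNormalCDF x := by
  unfold stdNormalCDF
  rw [integral_Iic_eq_integral_Iio]
  exact mul_pos bs_inv_pos (bs_pos _ _ isOpen_Iio nonempty_Iio bs_int fun t _ => Real.exp_pos _)

lemma bs_cdf_lt (x : ℝ) : stdNormalCDF x < 1 := by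
  have := mul_pos bs_inv_pos (bs_pos _ _ isOpen_Ioi (nonempty_Ioi (a := x)) bs_int
    fun t _ => Real.exp_pos _)
  rw [← bs_compl] at this
  linarith

open MeasureTheory in
lemma bs_key (A L v d : ℝ) (hA : 0 < A) (hv : 0 < v) (hd : d * v = L - v ^ 2 / 2) :
    A * Real.exp (-L) * stdNormalCDF d < A * stdNormalCDF (d + v) ∧
    A * (1 - stdNormalCDF (d + v)) < A * Real.exp (-L) * (1 - stdNormalCDF d) := by
  have hi : Integrable (fun t : ℝ => Real.exp (-(t + v) ^ 2 / 2)) := bs_int.comp_add_right v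
  have e : ∀ t : ℝ, Real.exp (-(t + v) ^ 2 / 2) = Real.exp (-t ^ 2 / 2) * Real.exp (-t*v - v^2/2) := by
    intro t; rw [← Real.exp_add]; congr 1; ring
  have s1 : ∫ t in Set.Iic (d + v), Real.exp (-t ^ 2 / 2)
      = ∫ t in Set.Iio d, Real.exp (-(t + v) ^ 2 / 2) := by
    have := (measurePreserving_add_right volume v).setIntegral_preimage_emb
      (measurableEmbedding_addRight v) (fun t : ℝ => Real.exp (-t ^ 2 / 2)) (Set.Iio (d + v))
    rw [integral_Iic_eq_integral_Iio, ← this]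
    simp
  have s2 : ∫ t in Set.Ioi (d + v), Real.exp (-t ^ 2 / 2)
      = ∫ t in Set.Ioi d, Real.exp (-(t + v) ^ 2 / 2) := by
    have := (measurePreserving_add_right volume v).setIntegral_preimage_emb
      (measurableEmbedding_addRight v) (fun t : ℝ => Real.exp (-t ^ 2 / 2)) (Set.Ioi (d + v))
    rw [← this]
    simp
  have p1 := bs_pos (fun t => Real.exp (-(t + v) ^ 2 / 2) - Real.exp (-L) * Real.exp (-t ^ 2 / 2))
    (Set.Iio d) isOpen_Iio nonempty_Iio (hi.sub (bs_int.const_mul _)) (by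
      intro t ht
      have ht : t < d := ht
      rw [e, mul_comm (Real.exp (-L)), ← mul_sub]
      refine mul_pos (Real.exp_pos _) (sub_pos.2 (Real.exp_lt_exp.2 ?_))
      nlinarith)
  have p2 := bs_pos (fun t => Real.exp (-L) * Real.exp (-t ^ 2 / 2) - Real.exp (-(t + v) ^ 2 / 2))
    (Set.Ioi d) isOpen_Ioi nonempty_Ioi ((bs_int.const_mul _).sub hi) (by
      intro t ht
      have ht : d < t := ht
      rw [e, mul_comm (Real.exp (-L)), ← mul_sub]
      refine mul_pos (Real.exp_pos _) (sub_pos.2 (Real.exp_lt_exp.2 ?_))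
      nlinarith)
  rw [integral_sub hi.integrableOn (bs_int.const_mul _).integrableOn, integral_const_mul,
    ← s1, ← integral_Iic_eq_integral_Iio] at p1
  rw [integral_sub (bs_int.const_mul _).integrableOn hi.integrableOn, integral_const_mul,
    ← s2] at p2
  have q1 := mul_pos (mul_pos hA bs_inv_pos) p1
  have q2 := mul_pos (mul_pos hA bs_inv_pos) p2
  rw [bs_compl, bs_compl]
  unfold stdNormalCDF
  constructor <;> linarith

/-- Strict no-arbitrage bounds for the Black–Scholes call price. -/
theorem stmt_6 (S K σ τ r δ : ℝ) (hS : 0 < S) (hK : 0 < K) (hσ : 0 < σ) (hτ : 0 < τ) :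
    max (S * Real.exp (-δ * τ) - K * Real.exp (-r * τ)) 0 < bsCall S σ r δ K τ ∧
    bsCall S σ r δ K τ < S * Real.exp (-δ * τ) := by
  have hv : 0 < σ * Real.sqrt τ := by positivity
  have hA : 0 < S * Real.exp (-δ * τ) := by positivity
  have hB : 0 < K * Real.exp (-r * τ) := by positivity
  have hAB : S * Real.exp (-δ * τ) * Real.exp (-(Real.log (S / K) + (r - δ) * τ))
      = K * Real.exp (-r * τ) := by
    rw [neg_add, Real.exp_add, Real.exp_neg (Real.log _), Real.exp_log (by positivity),
      show -r * τ = -δ * τ + -((r - δ) * τ) by ring, Real.exp_add]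
    field_simp
  have hk := bs_key (S * Real.exp (-δ * τ)) (Real.log (S / K) + (r - δ) * τ) (σ * Real.sqrt τ)
    (dMinus S σ r δ K τ) hA hv (by unfold dMinus; field_simp)
  have hd : dMinus S σ r δ K τ + σ * Real.sqrt τ = dPlus S σ r δ K τ := by
    unfold dMinus dPlus; ring
  rw [hAB, hd] at hk
  obtain ⟨h1, h2⟩ := hk
  have h3 := mul_pos hB (bs_cdf_pos (dMinus S σ r δ K τ))
  have h4 := mul_lt_mul_of_pos_left (bs_cdf_lt (dPlus S σ r δ K τ)) hA
  unfold bsCall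
  refine ⟨max_lt ?_ ?_, ?_⟩ <;> linarith
end
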